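/- Assume r_j ≤ 1 for all outcomes j. For every 0 < ε ≤ 1, the class L_ε of ε-discrete linear contracts is an ε-approximation of C_linear: for every finitely supported probability distribution D on Θ_all, OPT(L_ε, D) ≥ OPT(C_linear, D) − ε. -/

import Mathlib

open scoped BigOperators

/-- An agent type in the hidden-action principal-agent model with `n` actions and
`m` outcomes: a production function `f` (a distribution over outcomes for each action)
and a nonnegative cost vector `c` with `c 0 = 0`. -/
structure AgentType (n m : ℕ) where
  f : Fin n → Fin m → ℝ
  c : Fin n → ℝ
  f_nonneg : ∀ i j, 0 ≤ f i j
  f_sum : ∀ i, ∑ j, f i j = 1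
  c_nonneg : ∀ i, 0 ≤ c i
  c_zero : ∀ i : Fin n, (i : ℕ) = 0 → c i = 0

/-- The agent's expected utility for action `i` under contract `t`. -/
def uA {n m : ℕ} (θ : AgentType n m) (t : Fin m → ℝ) (i : Fin n) : ℝ :=
  (∑ j, θ.f i j * t j) - θ.c i

/-- The principal's expected utility when the agent takes action `i` under contract `t`,
with rewards `r`. -/
def uPa {n m : ℕ} (r : Fin m → ℝ) (θ : AgentType n m) (t : Fin m → ℝ) (i : Fin n) : ℝ :=
  ∑ j, θ.f i j * (r j - t j)

/-- The set of the agent's best-response actions to contract `t`. -/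
def BestResp {n m : ℕ} (θ : AgentType n m) (t : Fin m → ℝ) : Set (Fin n) :=
  {i | ∀ i', uA θ t i' ≤ uA θ t i}

/-- The principal's utility under contract `t`: the agent best-responds, breaking ties
in favor of the principal. -/
noncomputable def uP {n m : ℕ} (r : Fin m → ℝ) (θ : AgentType n m) (t : Fin m → ℝ) : ℝ :=
  sSup (uPa r θ t '' BestResp θ t)

/-- The class of linear contracts `α • r`, `α ∈ [0,1]`. -/
def Clinear {m : ℕ} (r : Fin m → ℝ) : Set (Fin m → ℝ) :=
  {t | ∃ α : ℝ, α ∈ Set.Icc (0:ℝ) 1 ∧ t = fun j => α * r j}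

/-- The class of bounded contracts `[0,1]^m`. -/
def Cbounded (m : ℕ) : Set (Fin m → ℝ) := {t | ∀ j, t j ∈ Set.Icc (0:ℝ) 1}

/-- The class of unbounded contracts `ℝ_{≥0}^m`. -/
def Cunbounded (m : ℕ) : Set (Fin m → ℝ) := {t | ∀ j, 0 ≤ t j}

/-- A finitely supported probability distribution. -/
structure FinDist (α : Type*) where
  p : α → ℝ
  nonneg : ∀ a, 0 ≤ p a
  finite_support : (Function.support p).Finite
  total : ∑ᶠ a, p a = 1

/-- Expectation of `g` under a finitely supported distribution `D`. -/
noncomputable def expect {α : Type*} (D : FinDist α) (g : α → ℝ) : ℝ :=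
  ∑ᶠ a, D.p a * g a

/-- `OPT(C, D)`: the supremum over contracts in `C` of the principal's expected utility. -/
noncomputable def OPT {n m : ℕ} (C : Set (Fin m → ℝ)) (r : Fin m → ℝ)
    (D : FinDist (AgentType n m)) : ℝ :=
  sSup ((fun t => expect D (fun θ => uP r θ t)) '' C)

/-- Pseudo-dimension shattering: `C` shatters some `k` types in `Θ`. -/
def Shatters {n m : ℕ} (r : Fin m → ℝ) (C : Set (Fin m → ℝ))
    (Θ : Set (AgentType n m)) (k : ℕ) : Prop :=
  ∃ θ : Fin k → AgentType n m, (∀ j, θ j ∈ Θ) ∧ ∃ τ : Fin k → ℝ,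
    ∀ S : Finset (Fin k), ∃ t ∈ C,
      (∀ j, j ∈ S → τ j ≤ uP r (θ j) t) ∧ (∀ j, j ∉ S → uP r (θ j) t < τ j)

/-- `Cbar` is an `ε`-approximation of `C` (representation error at most `ε`). -/
def IsApprox (n : ℕ) {m : ℕ} (r : Fin m → ℝ) (Cbar C : Set (Fin m → ℝ)) (ε : ℝ) : Prop :=
  ∀ D : FinDist (AgentType n m), OPT Cbar r D ≥ OPT C r D - ε

/-- Best responses breaking ties in favor of the principal. -/
def BestRespP {n m : ℕ} (r : Fin m → ℝ) (θ : AgentType n m) (t : Fin m → ℝ) : Set (Fin n) :=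
  {i | i ∈ BestResp θ t ∧ ∀ i' ∈ BestResp θ t, uPa r θ t i' ≤ uPa r θ t i}

/-- Principal's expected reward under the linear contract `α • r`. -/
noncomputable def rP {n m : ℕ} (r : Fin m → ℝ) (θ : AgentType n m) (α : ℝ) : ℝ :=
  sSup ((fun i => ∑ j, θ.f i j * r j) '' BestRespP r θ (fun j => α * r j))

/-- The set of critical values of an agent type for linear contracts. -/
def CritSet {n m : ℕ} (r : Fin m → ℝ) (θ : AgentType n m) : Set ℝ :=
  {α | α ∈ Set.Ioc (0:ℝ) 1 ∧ ∀ ε : ℝ, 0 < ε → ε ≤ α → rP r θ (α - ε) ≠ rP r θ α}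

/-- Probability of the event `E` under `N` i.i.d. samples from `D`. -/
noncomputable def prodProb {α : Type*} (D : FinDist α) (N : ℕ) (E : Set (Fin N → α)) : ℝ :=
  ∑ᶠ s ∈ E, ∏ i, D.p (s i)

/-- The class of `ε`-discrete linear contracts. -/
def Leps {m : ℕ} (r : Fin m → ℝ) (ε : ℝ) : Set (Fin m → ℝ) :=
  {t | ∃ α : ℝ, ((∃ k : ℕ, α = k * ε ∧ k * ε ≤ 1) ∨ α = 1) ∧ t = fun j => α * r j}

theorem BestResp_nonempty {n m : ℕ} (hn : 1 ≤ n) (θ : AgentType n m) (t : Fin m → ℝ) :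
    (BestResp θ t).Nonempty := by
  have : Nonempty (Fin n) := ⟨⟨0, hn⟩⟩
  exact Finite.exists_max (uA θ t)

theorem uPa_le_uP {n m : ℕ} (r : Fin m → ℝ) (θ : AgentType n m) (t : Fin m → ℝ) {i : Fin n}
    (hi : i ∈ BestResp θ t) : uPa r θ t i ≤ uP r θ t :=
  le_csSup (Set.toFinite _).bddAbove (Set.mem_image_of_mem _ hi)

theorem uP_le {n m : ℕ} (hn : 1 ≤ n) (r : Fin m → ℝ) (θ : AgentType n m) (t : Fin m → ℝ) {b : ℝ}
    (h : ∀ i ∈ BestResp θ t, uPa r θ t i ≤ b) : uP r θ t ≤ b := by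
  refine csSup_le ((BestResp_nonempty hn θ t).image _) ?_
  rintro _ ⟨i, hi, rfl⟩
  exact h i hi

/-- The expected reward of an action lies in `[0,1]` when all rewards do. -/
theorem expectedReward_mem_Icc {n m : ℕ} {r : Fin m → ℝ} (hr : ∀ j, 0 ≤ r j) (hr1 : ∀ j, r j ≤ 1)
    (θ : AgentType n m) (i : Fin n) : ∑ j, θ.f i j * r j ∈ Set.Icc (0 : ℝ) 1 := by
  refine ⟨Finset.sum_nonneg fun j _ => mul_nonneg (θ.f_nonneg i j) (hr j), ?_⟩
  rw [← θ.f_sum i]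
  exact Finset.sum_le_sum fun j _ => mul_le_of_le_one_right (θ.f_nonneg i j) (hr1 j)

theorem uA_linear {n m : ℕ} (r : Fin m → ℝ) (θ : AgentType n m) (α : ℝ) (i : Fin n) :
    uA θ (fun j => α * r j) i = α * (∑ j, θ.f i j * r j) - θ.c i := by
  simp only [uA, Finset.mul_sum, mul_left_comm]

theorem uPa_linear {n m : ℕ} (r : Fin m → ℝ) (θ : AgentType n m) (α : ℝ) (i : Fin n) :
    uPa r θ (fun j => α * r j) i = (1 - α) * ∑ j, θ.f i j * r j := by
  rw [uPa, Finset.mul_sum]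
  exact Finset.sum_congr rfl fun j _ => by ring

/-- Best responses to linear contracts have expected reward increasing in the contract. -/
theorem expectedReward_mono {n m : ℕ} (r : Fin m → ℝ) (θ : AgentType n m) {α β : ℝ} (hαβ : α < β)
    {i i' : Fin n} (hi : i ∈ BestResp θ fun j => α * r j)
    (hi' : i' ∈ BestResp θ fun j => β * r j) :
    ∑ j, θ.f i j * r j ≤ ∑ j, θ.f i' j * r j := by
  have h := hi i'
  have h' := hi' i
  simp only [uA_linear] at h h'
  nlinarith

/-- Raising a linear contract by at most `ε` costs the principal at most `ε`. -/
theorem uP_linear_le_add {n m : ℕ} (hn : 1 ≤ n) {r : Fin m → ℝ} (hr : ∀ j, 0 ≤ r j)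
    (hr1 : ∀ j, r j ≤ 1) (θ : AgentType n m) {α β ε : ℝ} (hαβ : α ≤ β) (hβε : β ≤ α + ε)
    (hβ1 : β ≤ 1) :
    uP r θ (fun j => α * r j) ≤ uP r θ (fun j => β * r j) + ε := by
  rcases hαβ.eq_or_lt with rfl | hlt
  · linarith
  refine uP_le hn _ _ _ fun i hi => ?_
  obtain ⟨i', hi'⟩ := BestResp_nonempty hn θ fun j => β * r j
  have hmono := expectedReward_mono r θ hlt hi hi'
  have hle := uPa_le_uP r θ _ hi'
  obtain ⟨h0, h1⟩ := expectedReward_mem_Icc hr hr1 θ i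
  rw [uPa_linear] at hle ⊢
  nlinarith [mul_le_mul_of_nonneg_left hmono (sub_nonneg.2 hβ1),
    mul_le_mul_of_nonneg_left h1 (sub_nonneg.2 hαβ)]

theorem uP_linear_le_one {n m : ℕ} (hn : 1 ≤ n) {r : Fin m → ℝ} (hr : ∀ j, 0 ≤ r j)
    (hr1 : ∀ j, r j ≤ 1) (θ : AgentType n m) {α : ℝ} (hα : 0 ≤ α) :
    uP r θ (fun j => α * r j) ≤ 1 := by
  refine uP_le hn _ _ _ fun i _ => ?_
  obtain ⟨h0, h1⟩ := expectedReward_mem_Icc hr hr1 θ i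
  rw [uPa_linear]
  nlinarith

theorem expect_le_expect_add {α : Type*} (D : FinDist α) {g h : α → ℝ} {ε : ℝ}
    (hgh : ∀ a, g a ≤ h a + ε) : expect D g ≤ expect D h + ε := by
  have hs : ∀ k : α → ℝ, expect D k = ∑ a ∈ D.finite_support.toFinset, D.p a * k a := fun k =>
    finsum_eq_sum_of_support_subset _ fun a ha => by
      simpa using left_ne_zero_of_mul (Function.mem_support.1 ha)
  have htot : ∑ a ∈ D.finite_support.toFinset, D.p a = 1 := by
    rw [← D.total, finsum_eq_sum _ D.finite_support]
  calc expect D g = ∑ a ∈ D.finite_support.toFinset, D.p a * g a := hs g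
    _ ≤ ∑ a ∈ D.finite_support.toFinset, D.p a * (h a + ε) :=
      Finset.sum_le_sum fun a _ => mul_le_mul_of_nonneg_left (hgh a) (D.nonneg a)
    _ = expect D h + ε := by
      simp only [mul_add, Finset.sum_add_distrib, ← Finset.sum_mul, htot, one_mul, hs]

/-- Every parameter in `[0,1]` can be rounded up to the `ε`-grid, moving by at most `ε`. -/
theorem exists_grid_ge {α ε : ℝ} (hα : α ∈ Set.Icc (0 : ℝ) 1) (hε : 0 < ε) :
    ∃ β : ℝ, ((∃ k : ℕ, β = k * ε ∧ k * ε ≤ 1) ∨ β = 1) ∧ α ≤ β ∧ β ≤ α + ε ∧ β ≤ 1 := by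
  have hle : α ≤ ⌈α / ε⌉₊ * ε := (div_le_iff₀ hε).1 (Nat.le_ceil _)
  have hlt : ⌈α / ε⌉₊ * ε ≤ α + ε := by
    have h := mul_le_mul_of_nonneg_right (Nat.ceil_lt_add_one (div_nonneg hα.1 hε.le)).le hε.le
    rwa [add_mul, div_mul_cancel₀ _ hε.ne', one_mul] at h
  by_cases h : ⌈α / ε⌉₊ * ε ≤ 1
  · exact ⟨_, Or.inl ⟨_, rfl, h⟩, hle, hlt, h⟩
  · exact ⟨1, Or.inr rfl, hα.2, (not_le.1 h).le.trans hlt, le_rfl⟩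

theorem bddAbove_expect_Leps {n m : ℕ} (hn : 1 ≤ n) {r : Fin m → ℝ} (hr : ∀ j, 0 ≤ r j)
    (hr1 : ∀ j, r j ≤ 1) {ε : ℝ} (hε : 0 < ε) (D : FinDist (AgentType n m)) :
    BddAbove ((fun t => expect D fun θ => uP r θ t) '' Leps r ε) := by
  refine ⟨expect D (fun _ => 0) + 1, ?_⟩
  rintro _ ⟨_, ⟨α, hα, rfl⟩, rfl⟩
  have hα0 : 0 ≤ α := by
    rcases hα with ⟨k, rfl, -⟩ | rfl <;> positivity
  refine expect_le_expect_add D fun θ => ?_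
  simpa using uP_linear_le_one hn hr hr1 θ hα0


/-- If all rewards are at most `1`, then for every `0 < ε ≤ 1`, the class
`L_ε` of `ε`-discrete linear contracts is an `ε`-approximation of `C_linear`:
`OPT(L_ε, D) ≥ OPT(C_linear, D) − ε` for every finitely supported distribution `D`. -/
theorem stmt_2 (n m : ℕ) (hn : 1 ≤ n) (hm : 2 ≤ m) (r : Fin m → ℝ)
    (hr : ∀ j, 0 ≤ r j) (hr0 : ∀ j : Fin m, (j : ℕ) = 0 → r j = 0) (hr1 : ∀ j, r j ≤ 1)
    (ε : ℝ) (hε0 : 0 < ε) (hε1 : ε ≤ 1) :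
    ∀ D : FinDist (AgentType n m), OPT (Leps r ε) r D ≥ OPT (Clinear r) r D - ε := by
  intro D
  rw [ge_iff_le, sub_le_iff_le_add]
  refine csSup_le (Set.Nonempty.image _ ⟨_, 0, by simp, rfl⟩) ?_
  rintro _ ⟨_, ⟨α, hα, rfl⟩, rfl⟩
  obtain ⟨β, hβ, hαβ, hβε, hβ1⟩ := exists_grid_ge hα hε0
  refine (expect_le_expect_add D fun θ =>
    uP_linear_le_add hn hr hr1 θ hαβ hβε hβ1).trans ?_
  gcongr
  exact le_csSup (bddAbove_expect_Leps hn hr hr1 hε0 D) (Set.mem_image_of_mem _ ⟨β, hβ, rfl⟩)
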